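/- arXiv:2310.05326 — 2 statements merged into one kernel-verified Lean document; each statement's English description precedes it below -/
import Mathlib

section
/- Let Ω ⊆ ℝⁿ (n ≥ 2) be a convex body. Then for every smooth function u : ℝⁿ → ℝ with compact support contained in the interior of Ω and with ∫_{ℝⁿ} |∇u|² dx > 0, one has (∫_{ℝⁿ} |u| dx)² ≤ (vol(Ω)^{(n+2)/n} / (n(n+2) ω_n^{2/n})) · ∫_{ℝⁿ} |∇u|² dx. Equivalently, the torsional rigidity satisfies T(Ω) ≤ vol(Ω)^{(n+2)/n} / (n(n+2) ω_n^{2/n}) (de Saint Venant inequality). -/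
open MeasureTheory

/-- The torsional rigidity of `Ω ⊆ ℝⁿ`:
`T(Ω) = sup { (∫ |u|)² / ∫ |∇u|² : u` smooth, compactly supported in the interior of `Ω`,
with `∫ |∇u|² > 0 }`. -/
noncomputable def torsion {n : ℕ} (Ω : Set (EuclideanSpace ℝ (Fin n))) : ℝ :=
  sSup {t : ℝ | ∃ u : EuclideanSpace ℝ (Fin n) → ℝ,
    ContDiff ℝ (⊤ : ℕ∞) u ∧ HasCompactSupport u ∧ tsupport u ⊆ interior Ω ∧
    0 < (∫ x, ‖gradient u x‖ ^ 2) ∧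
    t = (∫ x, |u x|) ^ 2 / ∫ x, ‖gradient u x‖ ^ 2}

/-- The volume of the Euclidean unit ball of `ℝⁿ`, in closed form. -/
noncomputable def unitBallVol (n : ℕ) : ℝ := √Real.pi ^ n / Real.Gamma ((n : ℝ) / 2 + 1)

theorem unitBallVol_pos (n : ℕ) : 0 < unitBallVol n :=
  div_pos (pow_pos (Real.sqrt_pos.2 Real.pi_pos) n) (Real.Gamma_pos_of_pos (by positivity))

theorem unitBallVol_zero : unitBallVol 0 = 1 := by
  simp [unitBallVol]

theorem continuous_sqrt_one_sub_sq_pow (k : ℕ) : Continuous fun y : ℝ => √(1 - y ^ 2) ^ k := by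
  fun_prop

theorem one_sub_sq_pos {y : ℝ} (hy : y ∈ Set.Ioo (-1 : ℝ) 1) : 0 < 1 - y ^ 2 := by
  nlinarith [hy.1, hy.2]

theorem hasDerivAt_mul_sqrt_one_sub_sq_pow (k : ℕ) {y : ℝ} (hy : y ∈ Set.Ioo (-1 : ℝ) 1) :
    HasDerivAt (fun y : ℝ => y * √(1 - y ^ 2) ^ (k + 2))
      (√(1 - y ^ 2) ^ k * (1 - (k + 3) * y ^ 2)) y := by
  have hpos := one_sub_sq_pos hy
  have h1 : HasDerivAt (fun y : ℝ => 1 - y ^ 2) (-(2 * y)) y := by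
    simpa using (hasDerivAt_pow 2 y).const_sub 1
  have h3 := (hasDerivAt_id y).mul ((h1.sqrt hpos.ne').pow (k + 2))
  refine h3.congr_deriv ?_
  have hs : 0 < √(1 - y ^ 2) := Real.sqrt_pos.2 hpos
  have hsq : √(1 - y ^ 2) ^ 2 = 1 - y ^ 2 := Real.sq_sqrt hpos.le
  simp only [Pi.pow_apply, id, Nat.add_succ_sub_one]
  set r := √(1 - y ^ 2)
  have : r ^ (k + 1) * (-(2 * y) / (2 * r)) = - (r ^ k * y) := by
    field_simp
    ring
  push_cast
  calc _ = r ^ k * r ^ 2 + y * ((k + 2) * (r ^ (k + 1) * (-(2 * y) / (2 * r)))) := by ring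
    _ = _ := by rw [this, hsq]; ring

theorem integral_sqrt_one_sub_sq_pow_add_two (k : ℕ) :
    (k + 3 : ℝ) * ∫ y in (-1 : ℝ)..1, √(1 - y ^ 2) ^ (k + 2) =
      (k + 2) * ∫ y in (-1 : ℝ)..1, √(1 - y ^ 2) ^ k := by
  have h := intervalIntegral.integral_eq_sub_of_hasDerivAt_of_le (a := (-1 : ℝ)) (b := 1)
    (by norm_num) (f := fun y : ℝ => y * √(1 - y ^ 2) ^ (k + 2))
    (f' := fun y : ℝ => √(1 - y ^ 2) ^ k * (1 - (k + 3) * y ^ 2)) (by fun_prop)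
    (fun y hy => hasDerivAt_mul_sqrt_one_sub_sq_pow k hy)
    (Continuous.intervalIntegrable (by fun_prop) _ _)
  have h2 : ∫ y in (-1 : ℝ)..1, √(1 - y ^ 2) ^ k * (1 - (k + 3) * y ^ 2) =
      ∫ y in (-1 : ℝ)..1, ((k + 3 : ℝ) * √(1 - y ^ 2) ^ (k + 2) - (k + 2) * √(1 - y ^ 2) ^ k) := by
    refine intervalIntegral.integral_congr fun y hy => ?_
    rw [Set.uIcc_of_le (by norm_num)] at hy
    have hsq : √(1 - y ^ 2) ^ 2 = 1 - y ^ 2 := Real.sq_sqrt (by nlinarith [hy.1, hy.2])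
    simp only [pow_add, hsq]
    ring
  rw [h2, intervalIntegral.integral_sub, intervalIntegral.integral_const_mul,
    intervalIntegral.integral_const_mul] at h
  · norm_num at h
    linarith
  all_goals exact Continuous.intervalIntegrable (by fun_prop) _ _

theorem integral_sqrt_one_sub_sq_pow (k : ℕ) :
    ∫ y in (-1 : ℝ)..1, √(1 - y ^ 2) ^ k = unitBallVol (k + 1) / unitBallVol k := by
  have hpi : √Real.pi ≠ 0 := (Real.sqrt_pos.2 Real.pi_pos).ne'
  have hpi2 : √Real.pi ^ 2 = Real.pi := Real.sq_sqrt Real.pi_pos.le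
  have h32 : Real.Gamma ((1 : ℝ) / 2 + 1) = √Real.pi / 2 := by
    rw [Real.Gamma_add_one (by norm_num), Real.Gamma_one_half_eq]; ring
  induction k using Nat.twoStepInduction with
  | zero =>
    simp only [unitBallVol, pow_zero, zero_add, Nat.cast_one, Nat.cast_zero, h32]
    norm_num
    field_simp
  | one =>
    simp only [pow_one, integral_sqrt_one_sub_sq, unitBallVol, Nat.cast_one, h32]
    norm_num
    field_simp
    linarith
  | more k ih _ =>
    have h := integral_sqrt_one_sub_sq_pow_add_two k
    rw [ih] at h
    have e : ∀ j : ℕ, unitBallVol (j + 2) = unitBallVol j * (Real.pi / ((j : ℝ) / 2 + 1)) := by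
      intro j
      have : ((j + 2 : ℕ) : ℝ) / 2 + 1 = ((j : ℝ) / 2 + 1) + 1 := by push_cast; ring
      rw [unitBallVol, unitBallVol, this, Real.Gamma_add_one (by positivity), pow_add, hpi2]
      have := (Real.Gamma_pos_of_pos (show 0 < (j : ℝ) / 2 + 1 by positivity)).ne'
      field_simp
    rw [show k + 2 + 1 = k + 1 + 2 by ring, e, e]
    have h0 := (unitBallVol_pos k).ne'
    have hpi3 := Real.pi_pos.ne'
    have h3 : (k + 3 : ℝ) ≠ 0 := by positivity
    apply mul_left_cancel₀ h3
    rw [h]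
    push_cast
    field_simp
    ring

/-- The monotone transport of a positive density on `[a, b]` to a multiple of
`(1 - y ^ 2) ^ (k / 2)` on `[-1, 1]`. -/
theorem exists_transport_to_sqrt_pow (k : ℕ) {a b : ℝ} (hab : a < b) {m : ℝ → ℝ}
    (hm : Continuous m) (hpos : ∀ x, 0 < m x) {κ : ℝ}
    (hκ : κ * ∫ y in (-1 : ℝ)..1, √(1 - y ^ 2) ^ k = ∫ x in a..b, m x) :
    ∃ τ : ℝ → ℝ, Continuous τ ∧ τ a = -1 ∧ τ b = 1 ∧ ∀ x ∈ Set.Ioo a b,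
      τ x ∈ Set.Ioo (-1 : ℝ) 1 ∧ HasDerivAt τ (m x / (κ * √(1 - τ x ^ 2) ^ k)) x := by
  set G : ℝ → ℝ := fun y => ∫ s in (-1 : ℝ)..y, √(1 - s ^ 2) ^ k with hG
  have hGd : ∀ y, HasDerivAt G (√(1 - y ^ 2) ^ k) y := fun y =>
    (continuous_sqrt_one_sub_sq_pow k).integral_hasStrictDerivAt _ _ |>.hasDerivAt
  have hGc : Continuous G := continuous_iff_continuousAt.2 fun y => (hGd y).continuousAt
  have hGmono : StrictMonoOn G (Set.Icc (-1) 1) := by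
    refine strictMonoOn_of_deriv_pos (convex_Icc _ _) hGc.continuousOn fun y hy => ?_
    rw [interior_Icc] at hy
    rw [(hGd y).deriv]
    exact pow_pos (Real.sqrt_pos.2 (one_sub_sq_pos hy)) k
  have hG0 : G (-1) = 0 := intervalIntegral.integral_same
  set M : ℝ → ℝ := fun x => ∫ s in a..x, m s with hM
  have hMd : ∀ x, HasDerivAt M (m x) x := fun x =>
    (hm.integral_hasStrictDerivAt _ _).hasDerivAt
  have hMc : Continuous M := continuous_iff_continuousAt.2 fun y => (hMd y).continuousAt
  have hMmono : StrictMono M := strictMono_of_deriv_pos fun x => by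
    rw [(hMd x).deriv]; exact hpos x
  have hM0 : M a = 0 := intervalIntegral.integral_same
  have hG1 : 0 < G 1 := hG0 ▸ hGmono (by simp) (by simp) (by norm_num)
  have hMb : 0 < M b := hM0 ▸ hMmono hab
  have hκ' : κ * G 1 = M b := hκ
  have hκ0 : 0 < κ := by
    by_contra hneg
    nlinarith [not_lt.1 hneg]
  have hex : ∀ x : ℝ, ∃ y : Set.Icc (-1 : ℝ) 1, κ * G y = M (Set.projIcc a b hab.le x) := by
    intro x
    have hx := (Set.projIcc a b hab.le x).2
    have h1 : M a ≤ M (Set.projIcc a b hab.le x) := hMmono.monotone hx.1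
    have h2 : M (Set.projIcc a b hab.le x) ≤ M b := hMmono.monotone hx.2
    obtain ⟨y, hy, hy'⟩ := intermediate_value_Icc (show (-1 : ℝ) ≤ 1 by norm_num)
      (f := fun y => κ * G y) (by fun_prop)
      (show M (Set.projIcc a b hab.le x) ∈ Set.Icc _ _ from
        ⟨by simp only [hG0, mul_zero]; linarith, by simp only [hκ']; exact h2⟩)
    exact ⟨⟨y, hy⟩, hy'⟩
  choose σ hσ using hex
  have hemb : Topology.IsClosedEmbedding (fun y : Set.Icc (-1 : ℝ) 1 => κ * G y) := by
    refine Continuous.isClosedEmbedding (by fun_prop) fun y z hyz => ?_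
    exact Subtype.ext (hGmono.injOn y.2 z.2 (mul_left_cancel₀ hκ0.ne' hyz))
  have hσc : Continuous σ := by
    rw [hemb.isInducing.continuous_iff]
    have : ((fun y : Set.Icc (-1 : ℝ) 1 => κ * G y) ∘ σ) =
        fun x => M (Set.projIcc a b hab.le x) := funext hσ
    rw [this]
    exact hMc.comp (continuous_subtype_val.comp continuous_projIcc)
  have hval : ∀ x ∈ Set.Icc a b, κ * G (σ x) = M x := fun x hx => by
    rw [hσ, Set.projIcc_of_mem _ hx]
  have hτc : Continuous fun x => (σ x : ℝ) := by fun_prop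
  refine ⟨fun x => σ x, hτc, ?_, ?_, fun x hx => ?_⟩
  · refine hGmono.injOn (σ a).2 (by simp) (mul_left_cancel₀ hκ0.ne' ?_)
    rw [hval a (by simp [hab.le]), hG0, hM0, mul_zero]
  · refine hGmono.injOn (σ b).2 (by simp) (mul_left_cancel₀ hκ0.ne' ?_)
    rw [hval b (by simp [hab.le]), hκ']
  · have hx' := hval x ⟨hx.1.le, hx.2.le⟩
    have hmem : (σ x : ℝ) ∈ Set.Ioo (-1 : ℝ) 1 := by
      have h1 := hMmono hx.1
      have h2 := hMmono hx.2
      constructor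
      · refine lt_of_le_of_ne (σ x).2.1 fun h => ?_
        rw [← h, hG0] at hx'
        linarith
      · refine lt_of_le_of_ne (σ x).2.2 fun h => ?_
        rw [h] at hx'
        linarith
    refine ⟨hmem, ?_⟩
    have hr : 0 < √(1 - (σ x : ℝ) ^ 2) ^ k := pow_pos (Real.sqrt_pos.2 (one_sub_sq_pos hmem)) k
    have hloc : HasDerivAt (fun z => (σ z : ℝ)) ((√(1 - (σ x : ℝ) ^ 2) ^ k)⁻¹ * (m x / κ)) x := by
      have hGs : HasStrictDerivAt G (√(1 - (σ x : ℝ) ^ 2) ^ k) (σ x) :=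
        (continuous_sqrt_one_sub_sq_pow k).integral_hasStrictDerivAt _ _
      have hMx : M x / κ = G (σ x) := by
        rw [div_eq_iff hκ0.ne', mul_comm, hx']
      have hL := (hGs.to_localInverse hr.ne').hasDerivAt
      rw [← hMx] at hL
      refine (hL.comp x ((hMd x).div_const κ)).congr_of_eventuallyEq ?_
      filter_upwards [hτc.continuousAt.eventually (hGs.eventually_left_inverse hr.ne'),
        Ioo_mem_nhds hx.1 hx.2] with z hz hz'
      have hMz : M z / κ = G (σ z) := by
        rw [div_eq_iff hκ0.ne', mul_comm, hval z ⟨hz'.1.le, hz'.2.le⟩]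
      rw [Function.comp_apply, hMz, hz]
    exact hloc.congr_deriv (by field_simp)

theorem mul_rpow_inv_le_add_mul (k : ℕ) {x s : ℝ} (hx : 0 ≤ x) (hs : 0 ≤ s) :
    (k + 1 : ℝ) * (x * s ^ k) ^ (1 / (k + 1 : ℝ)) ≤ x + k * s := by
  have hk : (0 : ℝ) < k + 1 := by positivity
  have h := Real.geom_mean_le_arith_mean2_weighted (w₁ := 1 / (k + 1 : ℝ)) (w₂ := k / (k + 1 : ℝ))
    (by positivity) (by positivity) hx hs (by field_simp; ring)
  have e : (x * s ^ k) ^ (1 / (k + 1 : ℝ)) = x ^ (1 / (k + 1 : ℝ)) * s ^ (k / (k + 1 : ℝ)) := by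
    rw [Real.mul_rpow hx (by positivity), ← Real.rpow_natCast s k, ← Real.rpow_mul hs]
    congr 2
    ring
  rw [e]
  calc _ ≤ (k + 1 : ℝ) * (1 / (k + 1 : ℝ) * x + k / (k + 1 : ℝ) * s) := by gcongr
    _ = x + k * s := by field_simp

/-- The induction step of the energy bound: `m`, `U`, `A`, `E` stand for the measure of a slice,
the integral over it, and the parts of the Dirichlet energy normal and tangent to it. -/
theorem integral_le_energy_of_slice_bound (k : ℕ) {a b : ℝ} (hab : a < b) {m U U' A E : ℝ → ℝ}
    (hm : Continuous m) (hpos : ∀ x, 0 < m x)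
    (hU : ∀ x, HasDerivAt U (U' x) x) (hU0 : ∀ x, 0 ≤ U x) (hUa : U a = 0) (hUb : U b = 0)
    (hm1 : k = 0 → ∀ x, U x ≠ 0 → 1 ≤ m x)
    (hA : ∀ x, U' x ^ 2 / m x ≤ A x)
    (hE : ∀ x, ∀ t : ℝ, 0 < t →
      k * (unitBallVol k / m x) ^ (1 / (k : ℝ)) * U x ≤
        t / 2 * E x + m x / (2 * t) * (k / (k + 2)))
    (hAi : IntegrableOn A (Set.Icc a b)) (hEi : IntegrableOn E (Set.Icc a b))
    {θ : ℝ} (hθ : 0 < θ) :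
    (k + 1 : ℝ) * (unitBallVol (k + 1) / ∫ x in a..b, m x) ^ (1 / (k + 1 : ℝ)) *
        ∫ x in a..b, U x ≤
      θ / 2 * (∫ x in a..b, (A x + E x)) +
        (∫ x in a..b, m x) / (2 * θ) * ((k + 1) / (k + 3)) := by
  set V := ∫ x in a..b, m x with hV
  have hVpos : 0 < V := intervalIntegral.intervalIntegral_pos_of_pos
    (hm.intervalIntegrable _ _) hpos hab
  have hω := unitBallVol_pos k
  have hω' := unitBallVol_pos (k + 1)
  set κ := V * unitBallVol k / unitBallVol (k + 1) with hκ
  have hκpos : 0 < κ := by positivity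
  obtain ⟨τ, hτc, hτa, hτb, hτ⟩ := exists_transport_to_sqrt_pow k hab hm hpos (κ := κ) (by
    rw [integral_sqrt_one_sub_sq_pow, hκ]; field_simp; exact hV)
  set L := (k + 1 : ℝ) * (unitBallVol (k + 1) / V) ^ (1 / (k + 1 : ℝ)) with hL
  set c : ℝ := 1 / (θ * ((k + 2) * (k + 3))) with hc
  have hUc : Continuous U := continuous_iff_continuousAt.2 fun y => (hU y).continuousAt
  have key := intervalIntegral.integral_le_sub_of_hasDeriv_right_of_le hab.le
    (g := fun x => U x * τ x - c * (κ * (τ x * √(1 - τ x ^ 2) ^ (k + 2))))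
    (g' := fun x => U' x * τ x + U x * (m x / (κ * √(1 - τ x ^ 2) ^ k)) -
      c * (m x * (1 - (k + 3) * τ x ^ 2)))
    (φ := fun x => L * U x - θ / 2 * (A x + E x) - m x * ((k + 1) / (k + 3) / (2 * θ)))
    (by fun_prop) (fun x hx => ?_) ?_ (fun x hx => ?_)
  · simp only [hUa, hUb, hτa, hτb] at key
    norm_num at key
    have i1 : IntervalIntegrable (fun x => L * U x) volume a b :=
      Continuous.intervalIntegrable (by fun_prop) _ _
    have i2 : IntervalIntegrable (fun x => θ / 2 * (A x + E x)) volume a b := by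
      rw [intervalIntegrable_iff_integrableOn_Icc_of_le hab.le]
      exact (hAi.add hEi).const_mul _
    have i3 : IntervalIntegrable (fun x => m x * ((k + 1) / (k + 3) / (2 * θ))) volume a b :=
      Continuous.intervalIntegrable (by fun_prop) _ _
    rw [intervalIntegral.integral_sub (i1.sub i2) i3, intervalIntegral.integral_sub i1 i2,
      intervalIntegral.integral_const_mul, intervalIntegral.integral_const_mul,
      intervalIntegral.integral_mul_const] at key
    have e : V / (2 * θ) * ((k + 1) / (k + 3)) = V * ((k + 1) / (k + 3) / (2 * θ)) := by ring
    rw [e]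
    linarith
  · obtain ⟨hmem, hd⟩ := hτ x hx
    have h1 := ((hU x).mul hd).sub
      ((((hasDerivAt_mul_sqrt_one_sub_sq_pow k hmem).comp x hd).const_mul κ).const_mul c)
    refine (h1.congr_deriv ?_).hasDerivWithinAt
    have hr : √(1 - τ x ^ 2) ^ k ≠ 0 := (pow_pos (Real.sqrt_pos.2 (one_sub_sq_pos hmem)) k).ne'
    field_simp
  · have hUi : IntegrableOn U (Set.Icc a b) := hUc.continuousOn.integrableOn_Icc
    have hmi : IntegrableOn m (Set.Icc a b) := hm.continuousOn.integrableOn_Icc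
    exact ((hUi.const_mul _).sub ((hAi.add hEi).const_mul _)).sub (hmi.mul_const _)
  · obtain ⟨hmem, -⟩ := hτ x hx
    have hρ : 0 < √(1 - τ x ^ 2) := Real.sqrt_pos.2 (one_sub_sq_pos hmem)
    have hρ2 : √(1 - τ x ^ 2) ^ 2 = 1 - τ x ^ 2 := Real.sq_sqrt (one_sub_sq_pos hmem).le
    set ρ := √(1 - τ x ^ 2)
    set y := τ x
    have hmx := hpos x
    have young : -(θ / 2 * A x + m x * y ^ 2 / (2 * θ)) ≤ U' x * y := by
      have h1 : θ / 2 * (U' x ^ 2 / m x) ≤ θ / 2 * A x := by gcongr; exact hA x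
      have h2 : 0 ≤ (θ * U' x + m x * y) ^ 2 / (2 * θ * m x) := by positivity
      have h3 : (θ * U' x + m x * y) ^ 2 / (2 * θ * m x) =
          θ / 2 * (U' x ^ 2 / m x) + U' x * y + m x * y ^ 2 / (2 * θ) := by
        field_simp
        ring
      linarith
    have slice : k * (unitBallVol k / m x) ^ (1 / (k : ℝ)) * ρ * U x ≤
        θ / 2 * E x + m x / (2 * θ) * (k / (k + 2)) * (1 - y ^ 2) := by
      have h1 := mul_le_mul_of_nonneg_left (hE x (θ / ρ) (by positivity)) hρ.le
      rw [← hρ2]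
      calc _ = ρ * (k * (unitBallVol k / m x) ^ (1 / (k : ℝ)) * U x) := by ring
        _ ≤ _ := h1
        _ = _ := by field_simp
    have amgm : L * U x ≤ U x * (m x / (κ * ρ ^ k)) +
        k * (unitBallVol k / m x) ^ (1 / (k : ℝ)) * ρ * U x := by
      rcases Nat.eq_zero_or_pos k with rfl | hk
      · by_cases hux : U x = 0
        · simp [hux]
        · have h1 := hm1 rfl x hux
          have h2 := hU0 x
          have h3 : L = 1 / κ := by
            simp only [hL, hκ, unitBallVol_zero]
            norm_num
          rw [h3]
          norm_num
          calc κ⁻¹ * U x = U x * (1 / κ) := by ring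
            _ ≤ U x * (m x / κ) := by gcongr
      · set q := (unitBallVol k / m x) ^ (1 / (k : ℝ))
        have hq0 : 0 ≤ q := by positivity
        have hq : q ^ k = unitBallVol k / m x := by
          rw [← Real.rpow_natCast, ← Real.rpow_mul (by positivity), one_div,
            inv_mul_cancel₀ (by exact_mod_cast hk.ne'), Real.rpow_one]
        have h1 := mul_rpow_inv_le_add_mul k (x := m x / (κ * ρ ^ k)) (s := q * ρ)
          (by positivity) (by positivity)
        have h2 : m x / (κ * ρ ^ k) * (q * ρ) ^ k = unitBallVol (k + 1) / V := by
          rw [mul_pow, hq, hκ]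
          field_simp
        rw [h2] at h1
        have h3 := mul_le_mul_of_nonneg_right h1 (hU0 x)
        calc L * U x ≤ _ := h3
          _ = _ := by ring
    have e : m x * y ^ 2 / (2 * θ) + m x / (2 * θ) * (k / (k + 2)) * (1 - y ^ 2) +
        c * (m x * (1 - (k + 3) * y ^ 2)) = m x * ((k + 1) / (k + 3) / (2 * θ)) := by
      rw [hc]
      field_simp
      ring
    linarith

section Slicing

variable {n : ℕ}

theorem continuous_finCons_real :
    Continuous fun p : ℝ × (Fin n → ℝ) => (Fin.cons p.1 p.2 : Fin (n + 1) → ℝ) :=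
  continuous_pi fun i => by
    refine Fin.cases ?_ (fun j => ?_) i
    · simpa using continuous_fst
    · simpa [Function.comp_def] using (continuous_apply j).comp continuous_snd

theorem continuous_slice {f : (Fin (n + 1) → ℝ) → ℝ} (hf : Continuous f) (t : ℝ) :
    Continuous fun y : Fin n → ℝ => f (Fin.cons t y) :=
  hf.comp (continuous_finCons_real.comp (Continuous.prodMk_right t))

theorem exists_isCompact_slice_eq_zero {f : (Fin (n + 1) → ℝ) → ℝ} (hc : HasCompactSupport f) :
    ∃ K : Set (Fin n → ℝ), IsCompact K ∧ ∀ t, ∀ y ∉ K, f (Fin.cons t y) = 0 := by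
  refine ⟨Fin.tail '' tsupport f, hc.isCompact.image (by unfold Fin.tail; fun_prop),
    fun t y hy => ?_⟩
  by_contra h
  exact hy ⟨_, subset_tsupport f h, Fin.tail_cons (α := fun _ => ℝ) t y⟩

theorem hasCompactSupport_slice {f : (Fin (n + 1) → ℝ) → ℝ} (hc : HasCompactSupport f) (t : ℝ) :
    HasCompactSupport fun y : Fin n → ℝ => f (Fin.cons t y) := by
  obtain ⟨K, hK, h⟩ := exists_isCompact_slice_eq_zero hc
  exact HasCompactSupport.intro hK (h t)

theorem integrable_slice {f : (Fin (n + 1) → ℝ) → ℝ} (hf : Continuous f) (hc : HasCompactSupport f)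
    (t : ℝ) : Integrable fun y : Fin n → ℝ => f (Fin.cons t y) :=
  (continuous_slice hf t).integrable_of_hasCompactSupport (hasCompactSupport_slice hc t)

theorem continuous_integral_slice {f : (Fin (n + 1) → ℝ) → ℝ} (hf : Continuous f)
    (hc : HasCompactSupport f) : Continuous fun t => ∫ y : Fin n → ℝ, f (Fin.cons t y) := by
  obtain ⟨K, hK, h⟩ := exists_isCompact_slice_eq_zero hc
  rw [← continuousOn_univ]
  refine continuousOn_integral_of_compact_support hK ?_ fun t y _ hy => h t y hy
  exact (hf.comp continuous_finCons_real).continuousOn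

theorem integral_eq_intervalIntegral_slice {f : (Fin (n + 1) → ℝ) → ℝ} (hf : Continuous f)
    (hc : HasCompactSupport f) {R : ℝ} (hR : -R ≤ R)
    (h0 : ∀ t, t ∉ Set.Ioc (-R) R → ∀ y, f (Fin.cons t y) = 0) :
    ∫ x, f x = ∫ t in -R..R, ∫ y : Fin n → ℝ, f (Fin.cons t y) := by
  have hmp := (volume_preserving_piFinSuccAbove (fun _ : Fin (n + 1) => ℝ) 0).symm
  have hemb := (MeasurableEquiv.piFinSuccAbove (fun _ : Fin (n + 1) => ℝ) 0).symm.measurableEmbedding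
  have hcons : ∀ p : ℝ × (Fin n → ℝ),
      (MeasurableEquiv.piFinSuccAbove (fun _ : Fin (n + 1) => ℝ) 0).symm p =
      Fin.cons p.1 p.2 := fun p => by
    simp [MeasurableEquiv.piFinSuccAbove_symm_apply, Fin.insertNthEquiv]
  have hint : Integrable fun p : ℝ × (Fin n → ℝ) => f (Fin.cons p.1 p.2) := by
    have := (hmp.integrable_comp_emb hemb).2 (hf.integrable_of_hasCompactSupport hc)
    simpa only [Function.comp_def, hcons] using this
  rw [← hmp.integral_comp hemb, intervalIntegral.integral_of_le hR,
    setIntegral_eq_integral_of_forall_compl_eq_zero fun t ht => by simp [h0 t ht]]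
  simp only [hcons]
  exact integral_prod _ hint

theorem hasDerivAt_finCons_left (t : ℝ) (y : Fin n → ℝ) :
    HasDerivAt (fun s => (Fin.cons s y : Fin (n + 1) → ℝ)) (Pi.single 0 1) t := by
  rw [hasDerivAt_pi]
  intro i
  refine Fin.cases ?_ (fun j => ?_) i
  · simpa using hasDerivAt_id' t
  · simpa using hasDerivAt_const t (y j)

theorem hasFDerivAt_finCons_right (t : ℝ) (y : Fin n → ℝ) :
    HasFDerivAt (fun z => (Fin.cons t z : Fin (n + 1) → ℝ))
      (ContinuousLinearMap.pi (Fin.cons (0 : (Fin n → ℝ) →L[ℝ] ℝ)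
        fun i => ContinuousLinearMap.proj (R := ℝ) i)) y := by
  rw [hasFDerivAt_pi']
  intro i
  refine Fin.cases ?_ (fun j => ?_) i
  · simpa using hasFDerivAt_const t y
  · simpa using hasFDerivAt_apply j y

theorem fderiv_slice {u : (Fin (n + 1) → ℝ) → ℝ} (hu : Differentiable ℝ u) (t : ℝ) (y : Fin n → ℝ)
    (j : Fin n) : fderiv ℝ (fun z : Fin n → ℝ => u (Fin.cons t z)) y (Pi.single j 1) =
      fderiv ℝ u (Fin.cons t y) (Pi.single j.succ 1) := by
  have h := (hu (Fin.cons t y)).hasFDerivAt.comp y (hasFDerivAt_finCons_right t y)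
  have e := h.fderiv
  simp only [Function.comp_def] at e
  rw [e, ContinuousLinearMap.comp_apply]
  congr 1
  ext i
  refine Fin.cases ?_ (fun i => ?_) i
  · simp
  · by_cases hij : i = j <;> simp [hij]

theorem contDiff_slice {u : (Fin (n + 1) → ℝ) → ℝ} (hu : ContDiff ℝ 1 u) (t : ℝ) :
    ContDiff ℝ 1 fun z : Fin n → ℝ => u (Fin.cons t z) := by
  refine hu.comp (contDiff_pi.2 fun i => ?_)
  refine Fin.cases ?_ (fun j => ?_) i
  · simpa using contDiff_const
  · simpa using contDiff_apply ℝ ℝ j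

theorem continuous_fderiv_apply_const {E : Type*} [NormedAddCommGroup E] [NormedSpace ℝ E]
    {u : E → ℝ} (hu : ContDiff ℝ 1 u) (v : E) : Continuous fun x => fderiv ℝ u x v :=
  (hu.continuous_fderiv one_ne_zero).clm_apply continuous_const

theorem hasCompactSupport_fderiv_apply_const {E : Type*} [NormedAddCommGroup E] [NormedSpace ℝ E]
    {u : E → ℝ} (hc : HasCompactSupport u) (v : E) :
    HasCompactSupport fun x => fderiv ℝ u x v :=
  hc.fderiv_apply ℝ v

theorem hasDerivAt_integral_slice {u : (Fin (n + 1) → ℝ) → ℝ} (hu : ContDiff ℝ 1 u)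
    (hc : HasCompactSupport u) (t : ℝ) :
    HasDerivAt (fun t => ∫ y : Fin n → ℝ, u (Fin.cons t y))
      (∫ y : Fin n → ℝ, fderiv ℝ u (Fin.cons t y) (Pi.single 0 1)) t := by
  have hdc := continuous_fderiv_apply_const hu (Pi.single 0 1 : Fin (n + 1) → ℝ)
  have hds := hasCompactSupport_fderiv_apply_const hc (Pi.single 0 1 : Fin (n + 1) → ℝ)
  obtain ⟨K, hK, h⟩ := exists_isCompact_slice_eq_zero hds
  obtain ⟨C, hC⟩ := hds.exists_bound_of_continuous hdc
  refine (hasDerivAt_integral_of_dominated_loc_of_deriv_le (s := Set.univ)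
    (F := fun t (y : Fin n → ℝ) => u (Fin.cons t y))
    (F' := fun t (y : Fin n → ℝ) => fderiv ℝ u (Fin.cons t y) (Pi.single 0 1))
    (bound := K.indicator fun _ => C) Filter.univ_mem ?_ (integrable_slice hu.continuous hc t)
    (continuous_slice hdc t).aestronglyMeasurable ?_ ?_ ?_).2
  · exact Filter.Eventually.of_forall fun s => (continuous_slice hu.continuous s).aestronglyMeasurable
  · refine Filter.Eventually.of_forall fun y s _ => ?_
    by_cases hy : y ∈ K
    · simpa [hy] using hC _
    · simp [hy, h s y hy]
  · exact (integrable_indicator_iff hK.measurableSet).2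
      (integrableOn_const hK.measure_lt_top.ne)
  · refine Filter.Eventually.of_forall fun y s _ => ?_
    exact ((hu.differentiable one_ne_zero _).hasFDerivAt).comp_hasDerivAt s (hasDerivAt_finCons_left s y)

theorem integral_fin_zero_real (f : (Fin 0 → ℝ) → ℝ) : ∫ x, f x = f 0 := by
  rw [Measure.volume_pi_eq_dirac 0, integral_dirac]

/-- The energy bound for nonnegative `u`; the cutoff `φ` controls the volume of the support. -/
theorem energy_bound_pi (n : ℕ) : ∀ (u φ : (Fin n → ℝ) → ℝ) (V θ : ℝ), ContDiff ℝ 1 u →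
    HasCompactSupport u → (∀ x, 0 ≤ u x) → Continuous φ → HasCompactSupport φ →
    (∀ x, 0 ≤ φ x) → (∀ x, u x ≠ 0 → φ x = 1) → ∫ x, φ x < V → 0 < θ →
    n * (unitBallVol n / V) ^ (1 / (n : ℝ)) * ∫ x, u x ≤
      θ / 2 * (∫ x, ∑ i, (fderiv ℝ u x (Pi.single i 1)) ^ 2) + V / (2 * θ) * (n / (n + 2)) := by
  induction n with
  | zero => intro u φ V θ _ _ _ _ _ _ _ _ _; simp
  | succ k ih =>
    intro u φ V θ hu huc hu0 hφ hφc hφ0 hφ1 hV hθ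
    obtain ⟨r, hr⟩ := hφc.isCompact.isBounded.subset_closedBall (0 : Fin (k + 1) → ℝ)
    set R := max r 0 + 1 with hR
    have hRpos : 0 < R := by positivity
    have hφR : ∀ t, t ∉ Set.Ioo (-R) R → ∀ y : Fin k → ℝ, φ (Fin.cons t y) = 0 := by
      intro t ht y
      by_contra h
      have h1 := hr (subset_tsupport φ h)
      rw [mem_closedBall_zero_iff] at h1
      have h2 := (norm_le_pi_norm (Fin.cons t y : Fin (k + 1) → ℝ) 0).trans h1
      simp only [Fin.cons_zero, Real.norm_eq_abs] at h2
      have h3 : |t| < R := by linarith [le_max_left r 0]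
      exact ht (abs_lt.1 h3)
    have huR : ∀ t, t ∉ Set.Ioo (-R) R → ∀ y : Fin k → ℝ, u (Fin.cons t y) = 0 := by
      intro t ht y
      by_contra h
      have := hφ1 _ h
      rw [hφR t ht y] at this
      exact zero_ne_one this
    have hdu0 : ∀ x v, u x = 0 → fderiv ℝ u x v = 0 := by
      intro x v hx
      have : IsLocalMin u x := Filter.Eventually.of_forall fun z => hx ▸ hu0 z
      rw [this.fderiv_eq_zero]
      rfl
    have hnot : ∀ t : ℝ, t ∉ Set.Ioc (-R) R → t ∉ Set.Ioo (-R) R :=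
      fun t ht h => ht (Set.Ioo_subset_Ioc_self h)
    have hRR : -R < R := by linarith
    set ε := (V - ∫ x, φ x) / (2 * R) with hε
    have hεpos : 0 < ε := div_pos (by linarith) (by positivity)
    set m : ℝ → ℝ := fun t => (∫ y : Fin k → ℝ, φ (Fin.cons t y)) + ε with hm
    have hmφ : ∀ t, ∫ y : Fin k → ℝ, φ (Fin.cons t y) < m t := fun t => by simp [hm, hεpos]
    have hm0 : ∀ t, 0 < m t := fun t => lt_of_le_of_lt (integral_nonneg fun y => hφ0 _) (hmφ t)
    have hmc : Continuous m := (continuous_integral_slice hφ hφc).add continuous_const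
    have hmV : ∫ t in -R..R, m t = V := by
      rw [hm, intervalIntegral.integral_add
        ((continuous_integral_slice hφ hφc).intervalIntegrable _ _) (by simp),
        ← integral_eq_intervalIntegral_slice hφ hφc hRR.le fun t ht => hφR t (hnot t ht)]
      simp only [intervalIntegral.integral_const, smul_eq_mul, hε]
      field_simp
      ring
    have hdiff := hu.differentiable one_ne_zero
    have hdc : ∀ i : Fin (k + 1), Continuous fun x => (fderiv ℝ u x (Pi.single i 1)) ^ 2 :=
      fun i => (continuous_fderiv_apply_const hu _).pow 2
    have hdsupp : ∀ i : Fin (k + 1),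
        HasCompactSupport fun x => (fderiv ℝ u x (Pi.single i 1)) ^ 2 := fun i =>
      (hasCompactSupport_fderiv_apply_const huc _).comp_left (g := fun s : ℝ => s ^ 2) (by simp)
    have htc : Continuous fun x => ∑ i : Fin k, (fderiv ℝ u x (Pi.single i.succ 1)) ^ 2 :=
      continuous_finsetSum _ fun i _ => hdc i.succ
    have htail : HasCompactSupport fun x =>
        ∑ i : Fin k, (fderiv ℝ u x (Pi.single i.succ 1)) ^ 2 := by
      refine HasCompactSupport.intro huc.isCompact fun x hx => ?_
      have hx0 : u x = 0 := image_eq_zero_of_notMem_tsupport hx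
      simp [hdu0 x _ hx0]
    set A : ℝ → ℝ := fun t => ∫ y : Fin k → ℝ, (fderiv ℝ u (Fin.cons t y) (Pi.single 0 1)) ^ 2 with hA
    set E : ℝ → ℝ := fun t =>
      ∫ y : Fin k → ℝ, ∑ i : Fin k, (fderiv ℝ u (Fin.cons t y) (Pi.single i.succ 1)) ^ 2 with hE
    have hAc : Continuous A := continuous_integral_slice (hdc 0) (hdsupp 0)
    have hEc : Continuous E := continuous_integral_slice htc htail
    have hsum : ∫ x, ∑ i, (fderiv ℝ u x (Pi.single i 1)) ^ 2 = ∫ t in -R..R, (A t + E t) := by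
      rw [intervalIntegral.integral_add (hAc.intervalIntegrable _ _) (hEc.intervalIntegrable _ _),
        ← integral_eq_intervalIntegral_slice (hdc 0) (hdsupp 0) hRR.le fun t ht y => by
          simp [hdu0 _ _ (huR t (hnot t ht) y)],
        ← integral_eq_intervalIntegral_slice htc htail hRR.le fun t ht y => by
          simp [hdu0 _ _ (huR t (hnot t ht) y)],
        ← integral_add ((hdc 0).integrable_of_hasCompactSupport (hdsupp 0))
          (htc.integrable_of_hasCompactSupport htail)]
      simp only [Fin.sum_univ_succ]
    have main := integral_le_energy_of_slice_bound k hRR (m := m)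
      (U := fun t => ∫ y : Fin k → ℝ, u (Fin.cons t y))
      (U' := fun t => ∫ y : Fin k → ℝ, fderiv ℝ u (Fin.cons t y) (Pi.single 0 1)) (A := A) (E := E)
      hmc hm0 (hasDerivAt_integral_slice hu huc) (fun t => integral_nonneg fun y => hu0 _)
      (by simp [huR (-R) (by simp)]) (by simp [huR R (by simp)]) ?_ (fun t => ?_) (fun t s hs => ?_)
      hAc.continuousOn.integrableOn_Icc hEc.continuousOn.integrableOn_Icc hθ
    · rw [hmV, ← hsum, ← integral_eq_intervalIntegral_slice hu.continuous huc hRR.le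
        fun t ht => huR t (hnot t ht)] at main
      push_cast
      rwa [show (k : ℝ) + 1 + 2 = k + 3 by ring]
    · rintro rfl t ht
      simp only [integral_fin_zero_real] at ht
      have : ∫ y : Fin 0 → ℝ, φ (Fin.cons t y) = 1 := by rw [integral_fin_zero_real, hφ1 _ ht]
      rw [← this]
      exact (hmφ t).le
    · set B := ∫ y : Fin k → ℝ, fderiv ℝ u (Fin.cons t y) (Pi.single 0 1) with hB
      have h1 : ∫ y : Fin k → ℝ, (2 * (B / m t) * fderiv ℝ u (Fin.cons t y) (Pi.single 0 1) -
          (B / m t) ^ 2 * φ (Fin.cons t y)) ≤ A t := by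
        have hi := integrable_slice (continuous_fderiv_apply_const hu _)
          (hasCompactSupport_fderiv_apply_const huc (Pi.single 0 1)) t
        refine integral_mono ((hi.const_mul _).sub ((integrable_slice hφ hφc t).const_mul _))
          (integrable_slice (hdc 0) (hdsupp 0) t) fun y => ?_
        by_cases hy : u (Fin.cons t y) = 0
        · simp only [hdu0 _ _ hy]
          nlinarith [mul_nonneg (sq_nonneg (B / m t)) (hφ0 (Fin.cons t y))]
        · simp only [hφ1 _ hy]
          nlinarith [sq_nonneg (fderiv ℝ u (Fin.cons t y) (Pi.single 0 1) - B / m t)]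
      rw [integral_sub, integral_const_mul, integral_const_mul, ← hB] at h1
      · have h2 := hm0 t
        have h3 : (B / m t) ^ 2 * ∫ y : Fin k → ℝ, φ (Fin.cons t y) ≤ (B / m t) ^ 2 * m t := by
          gcongr
          exact (hmφ t).le
        have h4 : B ^ 2 / m t = 2 * (B / m t) * B - (B / m t) ^ 2 * m t := by
          field_simp
          ring
        linarith
      · exact (integrable_slice (continuous_fderiv_apply_const hu _)
          (hasCompactSupport_fderiv_apply_const huc (Pi.single 0 1)) t).const_mul _
      · exact (integrable_slice hφ hφc t).const_mul _
    · have h := ih (fun y => u (Fin.cons t y)) (fun y => φ (Fin.cons t y)) (m t) s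
        (contDiff_slice hu t) (hasCompactSupport_slice huc t) (fun y => hu0 _)
        (continuous_slice hφ t) (hasCompactSupport_slice hφc t) (fun y => hφ0 _)
        (fun y => hφ1 _) (hmφ t) hs
      simpa only [fderiv_slice hdiff] using h

end Slicing

section Euclidean

variable {n : ℕ}

theorem volume_closedBall_zero_one_toReal (hn : 0 < n) :
    (volume (Metric.closedBall (0 : EuclideanSpace ℝ (Fin n)) 1)).toReal = unitBallVol n := by
  have : Nonempty (Fin n) := ⟨⟨0, hn⟩⟩
  rw [EuclideanSpace.volume_closedBall]
  simp only [ENNReal.ofReal_one, one_pow, one_mul, Fintype.card_fin]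
  exact ENNReal.toReal_ofReal (unitBallVol_pos n).le

theorem norm_gradient_eq_norm_fderiv {F : Type*} [NormedAddCommGroup F] [InnerProductSpace ℝ F]
    [CompleteSpace F] (u : F → ℝ) (x : F) : ‖gradient u x‖ = ‖fderiv ℝ u x‖ := by
  rw [← toDual_gradient, LinearIsometryEquiv.norm_map]

theorem norm_gradient_sq_eq_sum (u : EuclideanSpace ℝ (Fin n) → ℝ) (x : EuclideanSpace ℝ (Fin n)) :
    ‖gradient u x‖ ^ 2 = ∑ i, (fderiv ℝ u x (EuclideanSpace.single i 1)) ^ 2 := by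
  rw [EuclideanSpace.real_norm_sq_eq]
  refine Finset.sum_congr rfl fun i _ => ?_
  rw [← toDual_gradient, InnerProductSpace.toDual_apply_apply, EuclideanSpace.inner_single_right]
  simp

theorem energy_bound_of_nonneg {u : EuclideanSpace ℝ (Fin n) → ℝ}
    {O : Set (EuclideanSpace ℝ (Fin n))} {V θ : ℝ} (hu : ContDiff ℝ 1 u) (hc : HasCompactSupport u)
    (hu0 : ∀ x, 0 ≤ u x) (hO : IsOpen O) (hOfin : volume O ≠ ⊤) (hsub : tsupport u ⊆ O)
    (hV : (volume O).toReal < V) (hθ : 0 < θ) :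
    n * (unitBallVol n / V) ^ (1 / (n : ℝ)) * ∫ x, u x ≤
      θ / 2 * (∫ x, ‖gradient u x‖ ^ 2) + V / (2 * θ) * (n / (n + 2)) := by
  obtain ⟨φ, hφ1, hφc, hφsub, hφ01⟩ :=
    exists_continuousMap_one_of_isCompact_subset_isOpen hc.isCompact hO hsub
  set e := (PiLp.continuousLinearEquiv 2 ℝ fun _ : Fin n => ℝ).symm with he
  have hmp := PiLp.volume_preserving_toLp (Fin n)
  have hemb : MeasurableEmbedding (WithLp.toLp 2 : (Fin n → ℝ) → EuclideanSpace ℝ (Fin n)) :=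
    (MeasurableEquiv.toLp 2 (Fin n → ℝ)).measurableEmbedding
  have hint : ∀ f : EuclideanSpace ℝ (Fin n) → ℝ, ∫ y, f (e y) = ∫ x, f x := fun f =>
    hmp.integral_comp hemb f
  have hφV : ∫ x, φ x < V := by
    refine lt_of_le_of_lt ?_ hV
    have : ∫ x, O.indicator (fun _ => (1 : ℝ)) x = (volume O).toReal := by
      rw [integral_indicator hO.measurableSet]
      simp [Measure.real]
    rw [← this]
    refine integral_mono (φ.continuous.integrable_of_hasCompactSupport hφc)
      ((integrable_indicator_iff hO.measurableSet).2 (integrableOn_const hOfin)) fun x => ?_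
    by_cases hx : x ∈ O
    · simpa [hx] using (hφ01 x).2
    · have : φ x = 0 := image_eq_zero_of_notMem_tsupport fun h => hx (hφsub h)
      simp [hx, this]
  have h := energy_bound_pi n (fun y => u (e y)) (fun y => φ (e y)) V θ (hu.comp e.contDiff)
    (hc.comp_homeomorph e.toHomeomorph) (fun y => hu0 _) (φ.continuous.comp e.continuous)
    (HasCompactSupport.comp_homeomorph hφc e.toHomeomorph) (fun y => (hφ01 _).1)
    (fun y hy => hφ1 (subset_tsupport u hy)) (by rwa [hint]) hθ
  have hf : ∀ y i, fderiv ℝ (fun y => u (e y)) y (Pi.single i 1) =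
      fderiv ℝ u (e y) (EuclideanSpace.single i 1) := fun y i => by
    have := e.comp_right_fderiv (f := u) (x := y)
    simp only [Function.comp_def] at this
    rw [this]
    rfl
  simp only [hf, ← norm_gradient_sq_eq_sum] at h
  rwa [hint u, hint fun x => ‖gradient u x‖ ^ 2] at h

theorem norm_fderiv_sqrt_sq_add_sq_sub_le {E : Type*} [NormedAddCommGroup E] [NormedSpace ℝ E]
    {u : E → ℝ} (hu : Differentiable ℝ u) {ε : ℝ} (hε : 0 < ε) (x : E) :
    ‖fderiv ℝ (fun x => √(u x ^ 2 + ε ^ 2) - ε) x‖ ≤ ‖fderiv ℝ u x‖ := by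
  have hpos : 0 < u x ^ 2 + ε ^ 2 := by positivity
  have h := ((((hu x).hasFDerivAt.pow 2).add_const (ε ^ 2)).sqrt hpos.ne').sub_const ε
  rw [h.fderiv, smul_smul, norm_smul]
  refine mul_le_of_le_one_left (norm_nonneg _) ?_
  have hle : |u x| ≤ √(u x ^ 2 + ε ^ 2) := Real.abs_le_sqrt (by nlinarith)
  have hs : 0 < √(u x ^ 2 + ε ^ 2) := Real.sqrt_pos.2 hpos
  have e : 1 / (2 * √(u x ^ 2 + ε ^ 2)) * (2 • u x ^ (2 - 1)) = u x / √(u x ^ 2 + ε ^ 2) := by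
    simp
    field_simp
  rw [e, Real.norm_eq_abs, abs_div, abs_of_pos hs]
  exact (div_le_one hs).2 hle

theorem integrable_norm_gradient_sq {u : EuclideanSpace ℝ (Fin n) → ℝ} (hu : ContDiff ℝ 1 u)
    (hc : HasCompactSupport u) : Integrable fun x => ‖gradient u x‖ ^ 2 := by
  simp only [norm_gradient_eq_norm_fderiv]
  refine Continuous.integrable_of_hasCompactSupport
    ((hu.continuous_fderiv one_ne_zero).norm.pow 2) ?_
  exact (hc.fderiv ℝ).comp_left (g := fun L : EuclideanSpace ℝ (Fin n) →L[ℝ] ℝ => ‖L‖ ^ 2) (by simp)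

theorem energy_bound_abs_of_lt {u : EuclideanSpace ℝ (Fin n) → ℝ}
    {O : Set (EuclideanSpace ℝ (Fin n))} {V θ : ℝ} (hu : ContDiff ℝ 1 u) (hc : HasCompactSupport u)
    (hO : IsOpen O) (hOfin : volume O ≠ ⊤) (hsub : tsupport u ⊆ O)
    (hV : (volume O).toReal < V) (hθ : 0 < θ) :
    n * (unitBallVol n / V) ^ (1 / (n : ℝ)) * ∫ x, |u x| ≤
      θ / 2 * (∫ x, ‖gradient u x‖ ^ 2) + V / (2 * θ) * (n / (n + 2)) := by
  set L := n * (unitBallVol n / V) ^ (1 / (n : ℝ)) with hL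
  have hL0 : 0 ≤ L := by
    have := unitBallVol_pos n
    have : 0 < V := lt_of_le_of_lt ENNReal.toReal_nonneg hV
    positivity
  set W := (volume (tsupport u)).toReal with hW
  have key : ∀ ε : ℝ, 0 < ε → L * ∫ x, |u x| ≤
      (θ / 2 * (∫ x, ‖gradient u x‖ ^ 2) + V / (2 * θ) * (n / (n + 2))) + L * (ε * W) := by
    intro ε hε
    set w : EuclideanSpace ℝ (Fin n) → ℝ := fun x => √(u x ^ 2 + ε ^ 2) - ε with hw
    have hwd : ContDiff ℝ 1 w :=
      (((hu.pow 2).add contDiff_const).sqrt fun x => by positivity).sub contDiff_const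
    have hwsub : Function.support w ⊆ Function.support u := fun x hx h => hx (by
      simp [hw, h, Real.sqrt_sq hε.le])
    have hwts : tsupport w ⊆ tsupport u := closure_mono hwsub
    have hwc : HasCompactSupport w := hc.mono hwsub
    have hw0 : ∀ x, 0 ≤ w x := fun x => by
      have := Real.sqrt_le_sqrt (show ε ^ 2 ≤ u x ^ 2 + ε ^ 2 by nlinarith [sq_nonneg (u x)])
      rw [Real.sqrt_sq hε.le] at this
      simpa [hw] using this
    have h := energy_bound_of_nonneg hwd hwc hw0 hO hOfin (hwts.trans hsub) hV hθ
    have hgrad : ∫ x, ‖gradient w x‖ ^ 2 ≤ ∫ x, ‖gradient u x‖ ^ 2 := by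
      refine integral_mono (integrable_norm_gradient_sq hwd hwc)
        (integrable_norm_gradient_sq hu hc) fun x => ?_
      simp only [norm_gradient_eq_norm_fderiv]
      gcongr
      exact norm_fderiv_sqrt_sq_add_sq_sub_le (hu.differentiable one_ne_zero) hε x
    have hmeas : MeasurableSet (tsupport u) := (isClosed_tsupport u).measurableSet
    have hwi : Integrable w := hwd.continuous.integrable_of_hasCompactSupport hwc
    have hii : Integrable ((tsupport u).indicator fun _ => ε) :=
      (integrable_indicator_iff hmeas).2 (integrableOn_const hc.isCompact.measure_lt_top.ne)
    have habs : ∫ x, |u x| ≤ (∫ x, w x) + ε * W := by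
      have e : ∫ x, (tsupport u).indicator (fun _ => ε) x = ε * W := by
        rw [integral_indicator hmeas]
        simp [Measure.real, hW, mul_comm]
      rw [← e, ← integral_add hwi hii]
      refine integral_mono (hu.continuous.abs.integrable_of_hasCompactSupport
        (hc.comp_left (g := fun s : ℝ => |s|) (by simp))) (hwi.add hii) fun x => ?_
      by_cases hx : x ∈ tsupport u
      · have : |u x| ≤ √(u x ^ 2 + ε ^ 2) := Real.abs_le_sqrt (by nlinarith)
        simpa [hw, hx] using this
      · simp [image_eq_zero_of_notMem_tsupport hx, hw0 x, hx]
    calc L * ∫ x, |u x| ≤ L * ((∫ x, w x) + ε * W) := by gcongr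
      _ = L * (∫ x, w x) + L * (ε * W) := by ring
      _ ≤ (θ / 2 * (∫ x, ‖gradient w x‖ ^ 2) + V / (2 * θ) * (n / (n + 2))) + L * (ε * W) := by
        gcongr
      _ ≤ _ := by gcongr
  have hlim : Filter.Tendsto (fun ε : ℝ => (θ / 2 * (∫ x, ‖gradient u x‖ ^ 2) +
      V / (2 * θ) * (n / (n + 2))) + L * (ε * W)) (nhdsWithin 0 (Set.Ioi 0)) (nhds
        ((θ / 2 * (∫ x, ‖gradient u x‖ ^ 2) + V / (2 * θ) * (n / (n + 2))) + L * (0 * W))) :=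
    (Continuous.tendsto (by fun_prop) 0).mono_left nhdsWithin_le_nhds
  have := ge_of_tendsto hlim (Filter.eventually_of_mem self_mem_nhdsWithin key)
  simpa using this

theorem energy_bound_abs {u : EuclideanSpace ℝ (Fin n) → ℝ}
    {O : Set (EuclideanSpace ℝ (Fin n))} {V θ : ℝ} (hu : ContDiff ℝ 1 u) (hc : HasCompactSupport u)
    (hO : IsOpen O) (hOfin : volume O ≠ ⊤) (hsub : tsupport u ⊆ O)
    (hV0 : 0 < V) (hV : (volume O).toReal ≤ V) (hθ : 0 < θ) :
    n * (unitBallVol n / V) ^ (1 / (n : ℝ)) * ∫ x, |u x| ≤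
      θ / 2 * (∫ x, ‖gradient u x‖ ^ 2) + V / (2 * θ) * (n / (n + 2)) := by
  have h1 : ContinuousAt (fun V : ℝ => n * (unitBallVol n / V) ^ (1 / (n : ℝ)) * ∫ x, |u x|) V :=
    ((continuousAt_const.mul ((continuousAt_const.div continuousAt_id hV0.ne').rpow_const
      (Or.inr (by positivity)))).mul continuousAt_const)
  have h2 : ContinuousAt (fun V : ℝ => θ / 2 * (∫ x, ‖gradient u x‖ ^ 2) +
      V / (2 * θ) * (n / (n + 2))) V := by fun_prop
  exact le_of_tendsto_of_tendsto (h1.tendsto.mono_left nhdsWithin_le_nhds)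
    (h2.tendsto.mono_left (nhdsWithin_le_nhds (s := Set.Ioi V)))
    (Filter.eventually_of_mem self_mem_nhdsWithin fun V' hV' =>
      energy_bound_abs_of_lt hu hc hO hOfin hsub (lt_of_le_of_lt hV hV') hθ)

theorem sq_le_mul_of_forall_le {D β Y : ℝ} (hD : 0 < D) (hβ : 0 ≤ β) (hY : 0 ≤ Y)
    (h : ∀ θ : ℝ, 0 < θ → Y ≤ θ / 2 * D + β / (2 * θ)) : Y ^ 2 ≤ β * D := by
  rcases hY.eq_or_lt with rfl | hY
  · simpa using mul_nonneg hβ hD.le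
  · have h1 := h (Y / D) (by positivity)
    have e : Y / D / 2 * D + β / (2 * (Y / D)) = Y / 2 + β * D / (2 * Y) := by field_simp
    rw [e] at h1
    have h2 : Y / 2 ≤ β * D / (2 * Y) := by linarith
    rw [le_div_iff₀ (by positivity)] at h2
    linarith

theorem sq_integral_abs_le (hn : 0 < n) {u : EuclideanSpace ℝ (Fin n) → ℝ}
    {O : Set (EuclideanSpace ℝ (Fin n))} {V : ℝ} (hu : ContDiff ℝ 1 u) (hc : HasCompactSupport u)
    (hO : IsOpen O) (hOfin : volume O ≠ ⊤) (hsub : tsupport u ⊆ O)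
    (hV0 : 0 < V) (hV : (volume O).toReal ≤ V) (hD : 0 < ∫ x, ‖gradient u x‖ ^ 2) :
    (∫ x, |u x|) ^ 2 ≤ V ^ (((n : ℝ) + 2) / n) /
      ((n : ℝ) * ((n : ℝ) + 2) * unitBallVol n ^ ((2 : ℝ) / n)) * ∫ x, ‖gradient u x‖ ^ 2 := by
  have hn' : (0 : ℝ) < n := by exact_mod_cast hn
  have hω := unitBallVol_pos n
  set X := ∫ x, |u x| with hX
  set D := ∫ x, ‖gradient u x‖ ^ 2 with hDdef
  have hX0 : 0 ≤ X := integral_nonneg fun x => abs_nonneg _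
  have h := sq_le_mul_of_forall_le (D := D) (β := V * (n / (n + 2)))
    (Y := n * (unitBallVol n / V) ^ (1 / (n : ℝ)) * X) hD (by positivity) (by positivity)
    fun θ hθ => by
      refine (energy_bound_abs hu hc hO hOfin hsub hV0 hV hθ).trans_eq ?_
      ring
  have e1 : ((unitBallVol n / V) ^ (1 / (n : ℝ))) ^ 2 =
      unitBallVol n ^ ((2 : ℝ) / n) / V ^ ((2 : ℝ) / n) := by
    rw [← Real.rpow_natCast, ← Real.rpow_mul (by positivity), Real.div_rpow hω.le hV0.le]
    norm_num
    ring_nf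
  have e2 : V ^ (((n : ℝ) + 2) / n) = V * V ^ ((2 : ℝ) / n) := by
    rw [add_div, div_self hn'.ne', Real.rpow_add hV0, Real.rpow_one]
  rw [mul_pow, mul_pow, e1] at h
  rw [e2]
  have hp : 0 < unitBallVol n ^ ((2 : ℝ) / n) := by positivity
  have hq : 0 < V ^ ((2 : ℝ) / n) := by positivity
  set p := unitBallVol n ^ ((2 : ℝ) / n)
  set q := V ^ ((2 : ℝ) / n)
  have hc0 : 0 < (n : ℝ) ^ 2 * (p / q) := by positivity
  refine le_of_mul_le_mul_left (h.trans_eq ?_) hc0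
  field_simp

end Euclidean

theorem de_saint_venant_inequality
    {n : ℕ} (hn : 2 ≤ n)
    (Ω : Set (EuclideanSpace ℝ (Fin n)))
    (hcpt : IsCompact Ω) (hconv : Convex ℝ Ω) (hint : (interior Ω).Nonempty) :
    (∀ u : EuclideanSpace ℝ (Fin n) → ℝ,
      ContDiff ℝ (⊤ : ℕ∞) u → HasCompactSupport u → tsupport u ⊆ interior Ω →
      0 < (∫ x, ‖gradient u x‖ ^ 2) →
      (∫ x, |u x|) ^ 2 ≤
        ((volume Ω).toReal ^ (((n : ℝ) + 2) / n) /
            ((n : ℝ) * ((n : ℝ) + 2) *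
              ((volume (Metric.closedBall (0 : EuclideanSpace ℝ (Fin n)) 1)).toReal)
                ^ ((2 : ℝ) / n))) *
          ∫ x, ‖gradient u x‖ ^ 2) ∧
    torsion Ω ≤
      (volume Ω).toReal ^ (((n : ℝ) + 2) / n) /
        ((n : ℝ) * ((n : ℝ) + 2) *
          ((volume (Metric.closedBall (0 : EuclideanSpace ℝ (Fin n)) 1)).toReal)
            ^ ((2 : ℝ) / n)) := by
  have hn0 : 0 < n := by omega
  rw [volume_closedBall_zero_one_toReal hn0]
  have hfin : volume Ω ≠ ⊤ := hcpt.measure_lt_top.ne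
  have hle : volume (interior Ω) ≤ volume Ω := measure_mono interior_subset
  have hpos : 0 < (volume Ω).toReal :=
    ENNReal.toReal_pos ((isOpen_interior.measure_pos volume hint).trans_le hle).ne' hfin
  have main : ∀ u : EuclideanSpace ℝ (Fin n) → ℝ,
      ContDiff ℝ (⊤ : ℕ∞) u → HasCompactSupport u → tsupport u ⊆ interior Ω →
      0 < (∫ x, ‖gradient u x‖ ^ 2) →
      (∫ x, |u x|) ^ 2 ≤ (volume Ω).toReal ^ (((n : ℝ) + 2) / n) /
        ((n : ℝ) * ((n : ℝ) + 2) * unitBallVol n ^ ((2 : ℝ) / n)) * ∫ x, ‖gradient u x‖ ^ 2 :=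
    fun u hu hc hsub hD => sq_integral_abs_le hn0 (hu.of_le (by exact_mod_cast le_top)) hc
      isOpen_interior (ne_top_of_le_ne_top hfin hle) hsub hpos (ENNReal.toReal_mono hfin hle) hD
  refine ⟨main, Real.sSup_le ?_ ?_⟩
  · rintro t ⟨u, hu, hc, hsub, hD, rfl⟩
    exact (div_le_iff₀ hD).2 (main u hu hc hsub hD)
  · have := unitBallVol_pos n
    positivity
end

section
/- Let (Ω_i)_{i≥1} and Ω₀ be convex bodies in ℝⁿ (n ≥ 2) such that Ω_i converges to Ω₀ in the Hausdorff metric as i → ∞. Then the torsional rigidities converge: T(Ω_i) → T(Ω₀) as i → ∞. -/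
open MeasureTheory Filter

/-- The values of the torsion quotient over all admissible test functions on `Ω`. -/
def torsionQuotients {n : ℕ} (Ω : Set (EuclideanSpace ℝ (Fin n))) : Set ℝ :=
  {t : ℝ | ∃ u : EuclideanSpace ℝ (Fin n) → ℝ,
    ContDiff ℝ (⊤ : ℕ∞) u ∧ HasCompactSupport u ∧ tsupport u ⊆ interior Ω ∧
    0 < (∫ x, ‖gradient u x‖ ^ 2) ∧
    t = (∫ x, |u x|) ^ 2 / ∫ x, ‖gradient u x‖ ^ 2}

theorem torsionQuotients_nonneg {n : ℕ} {Ω : Set (EuclideanSpace ℝ (Fin n))} {t : ℝ}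
    (ht : t ∈ torsionQuotients Ω) : 0 ≤ t := by
  obtain ⟨u, -, -, -, hpos, rfl⟩ := ht
  positivity

theorem torsion_nonneg {n : ℕ} (Ω : Set (EuclideanSpace ℝ (Fin n))) : 0 ≤ torsion Ω :=
  Real.sSup_nonneg fun _ ht => torsionQuotients_nonneg ht

theorem norm_gradient_eq_norm_fderiv_s17 {n : ℕ} (u : EuclideanSpace ℝ (Fin n) → ℝ)
    (x : EuclideanSpace ℝ (Fin n)) : ‖gradient u x‖ = ‖fderiv ℝ u x‖ := by
  simp [gradient]

theorem norm_gradient_comp_homothety {n : ℕ} {u : EuclideanSpace ℝ (Fin n) → ℝ}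
    (hu : Differentiable ℝ u) {c : ℝ} (hc : 0 < c) (p x : EuclideanSpace ℝ (Fin n)) :
    ‖gradient (fun y => u (p + c • (y - p))) x‖ = c * ‖gradient u (p + c • (x - p))‖ := by
  have h1 : HasFDerivAt (fun y : EuclideanSpace ℝ (Fin n) => p + c • (y - p))
      (c • ContinuousLinearMap.id ℝ (EuclideanSpace ℝ (Fin n))) x :=
    (((hasFDerivAt_id x).sub_const p).const_smul c).const_add p
  have h2 := (hu (p + c • (x - p))).hasFDerivAt.comp x h1
  rw [norm_gradient_eq_norm_fderiv_s17, norm_gradient_eq_norm_fderiv_s17]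
  have h3 : fderiv ℝ (fun y => u (p + c • (y - p))) x = c • fderiv ℝ u (p + c • (x - p)) := by
    rw [show (fun y => u (p + c • (y - p))) = u ∘ fun y => p + c • (y - p) from rfl, h2.fderiv]
    ext v
    simp
  rw [h3, norm_smul, Real.norm_of_nonneg hc.le]

theorem integral_comp_homothety {n : ℕ} (f : EuclideanSpace ℝ (Fin n) → ℝ) {c : ℝ} (hc : 0 < c)
    (p : EuclideanSpace ℝ (Fin n)) :
    ∫ x, f (p + c • (x - p)) = (c ^ n)⁻¹ * ∫ x, f x := by
  rw [integral_sub_right_eq_self (fun x => f (p + c • x)) p,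
    Measure.integral_comp_smul volume (fun x => f (p + x)) c, integral_add_left_eq_self f p,
    finrank_euclideanSpace_fin, abs_of_pos (by positivity), smul_eq_mul]

theorem smul_mem_torsionQuotients {n : ℕ} {K L : Set (EuclideanSpace ℝ (Fin n))} {c : ℝ}
    (hc : 0 < c) {p : EuclideanSpace ℝ (Fin n)} (hKL : ∀ x ∈ K, p + c • (x - p) ∈ L) {t : ℝ}
    (ht : t ∈ torsionQuotients K) : c ^ (n + 2) * t ∈ torsionQuotients L := by
  obtain ⟨u, hu, hsupp, hsub, hpos, rfl⟩ := ht
  have hci : 0 < c⁻¹ := inv_pos.2 hc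
  let φ : EuclideanSpace ℝ (Fin n) ≃ₜ EuclideanSpace ℝ (Fin n) :=
    { toFun := fun x => p + c⁻¹ • (x - p)
      invFun := fun x => p + c • (x - p)
      left_inv := fun x => by simp [smul_smul, hc.ne']
      right_inv := fun x => by simp [smul_smul, hc.ne']
      continuous_toFun := by fun_prop
      continuous_invFun := by fun_prop }
  have hφ : ContDiff ℝ (⊤ : ℕ∞) φ :=
    show ContDiff ℝ (⊤ : ℕ∞) fun x : EuclideanSpace ℝ (Fin n) => p + c⁻¹ • (x - p) by fun_prop
  have hgrad : ∫ x, ‖gradient (u ∘ φ) x‖ ^ 2 =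
      c⁻¹ ^ 2 * ((c⁻¹ ^ n)⁻¹ * ∫ x, ‖gradient u x‖ ^ 2) := by
    rw [← integral_comp_homothety (fun x => ‖gradient u x‖ ^ 2) hci p, ← integral_const_mul]
    congr 1 with x
    rw [← mul_pow, ← norm_gradient_comp_homothety (hu.differentiable (by simp)) hci p x]
    rfl
  have hval : ∫ x, |(u ∘ φ) x| = (c⁻¹ ^ n)⁻¹ * ∫ x, |u x| :=
    integral_comp_homothety (fun x => |u x|) hci p
  refine ⟨u ∘ φ, hu.comp hφ,
    hsupp.comp_homeomorph φ, ?_, ?_, ?_⟩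
  · have hpre : tsupport (u ∘ φ) ⊆ φ ⁻¹' tsupport u :=
      tsupport_comp_subset_preimage u φ.continuous
    refine (hpre.trans (Set.preimage_mono hsub)).trans
      (interior_maximal (fun x hx => ?_) (isOpen_interior.preimage φ.continuous))
    have hmem := hKL _ (interior_subset hx)
    have heq : p + c • (φ x - p) = x := φ.left_inv x
    rwa [heq] at hmem
  · rw [hgrad]
    positivity
  · rw [hgrad, hval, inv_pow, inv_pow, inv_inv]
    field_simp
    ring

theorem BddAbove.torsionQuotients_of_homothety {n : ℕ} {K L : Set (EuclideanSpace ℝ (Fin n))}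
    {c : ℝ} (hc : 0 < c) {p : EuclideanSpace ℝ (Fin n)} (hKL : ∀ x ∈ K, p + c • (x - p) ∈ L)
    (hL : BddAbove (torsionQuotients L)) : BddAbove (torsionQuotients K) := by
  obtain ⟨M, hM⟩ := hL
  refine ⟨M / c ^ (n + 2), fun t ht => ?_⟩
  rw [le_div_iff₀' (by positivity)]
  exact hM (smul_mem_torsionQuotients hc hKL ht)

theorem mul_torsion_le_of_homothety {n : ℕ} {K L : Set (EuclideanSpace ℝ (Fin n))}
    {c : ℝ} (hc : 0 < c) {p : EuclideanSpace ℝ (Fin n)} (hKL : ∀ x ∈ K, p + c • (x - p) ∈ L)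
    (hL : BddAbove (torsionQuotients L)) : c ^ (n + 2) * torsion K ≤ torsion L := by
  rw [← le_div_iff₀' (by positivity)]
  refine Real.sSup_le (fun t ht => ?_) (div_nonneg (torsion_nonneg L) (by positivity))
  rw [le_div_iff₀' (by positivity)]
  exact le_csSup hL (smul_mem_torsionQuotients hc hKL ht)

theorem Convex.homothety_mem_of_near {E : Type*} [NormedAddCommGroup E] [NormedSpace ℝ E]
    {K : Set E} (hK : Convex ℝ K) {p : E} {r ε : ℝ} (hε : 0 < ε)
    (hball : Metric.closedBall p r ⊆ K) {x y : E} (hy : y ∈ K) (hxy : dist x y < ε * r) :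
    p + (1 + ε)⁻¹ • (x - p) ∈ K := by
  have hw : p + ε⁻¹ • (x - y) ∈ K := by
    apply hball
    rw [Metric.mem_closedBall, dist_eq_norm, add_sub_cancel_left, norm_smul, ← dist_eq_norm,
      Real.norm_of_nonneg (by positivity), inv_mul_le_iff₀ hε]
    exact hxy.le
  have h := hK hy hw (a := (1 + ε)⁻¹) (b := (1 + ε)⁻¹ * ε) (by positivity) (by positivity)
    (by field_simp)
  convert h using 1
  match_scalars <;> field_simp <;> ring

theorem Convex.homothety_mem_of_forall_near {E : Type*} [NormedAddCommGroup E]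
    [InnerProductSpace ℝ E] {K L : Set E} (hK : Convex ℝ K) (hL : Convex ℝ L)
    (hLc : IsComplete L) (hLne : L.Nonempty) {p : E} {r ε : ℝ} (hr : 0 < r) (hε : 0 < ε)
    (hε1 : ε < 1) (hball : Metric.closedBall p r ⊆ K)
    (hnear : ∀ x ∈ K, ∃ y ∈ L, dist x y < ε * r) {x : E} (hx : x ∈ K) :
    p + (1 - ε) • (x - p) ∈ L := by
  set q := p + (1 - ε) • (x - p) with hq
  obtain ⟨y₀, hy₀, hmin⟩ := exists_norm_eq_iInf_of_complete_convex hLne hLc hL q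
  rw [norm_eq_iInf_iff_real_inner_le_zero hL hy₀] at hmin
  by_contra hqL
  set v := q - y₀ with hv
  have hv0 : 0 < ‖v‖ := norm_pos_iff.2 fun h => hqL (sub_eq_zero.1 h ▸ hy₀)
  have hw : p + (r / ‖v‖) • v ∈ K := by
    apply hball
    rw [Metric.mem_closedBall, dist_eq_norm, add_sub_cancel_left, norm_smul,
      Real.norm_of_nonneg (by positivity), div_mul_cancel₀ _ hv0.ne']
  have hmem := hK hx hw (a := 1 - ε) (b := ε) (by linarith) hε.le (by ring)
  have heq : (1 - ε) • x + ε • (p + (r / ‖v‖) • v) = q + (ε * r / ‖v‖) • v := by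
    rw [hq]
    match_scalars <;> ring
  rw [heq] at hmem
  obtain ⟨y, hy, hdist⟩ := hnear _ hmem
  rw [dist_eq_norm] at hdist
  have h1 : inner ℝ v (q + (ε * r / ‖v‖) • v - y) =
      ‖v‖ ^ 2 - inner ℝ v (y - y₀) + ε * r * ‖v‖ := by
    rw [show q + (ε * r / ‖v‖) • v - y = v - (y - y₀) + (ε * r / ‖v‖) • v by rw [hv]; abel,
      inner_add_right, inner_sub_right, inner_smul_right, real_inner_self_eq_norm_sq]
    field_simp
  have h2 := real_inner_le_norm v (q + (ε * r / ‖v‖) • v - y)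
  have h3 := hmin y hy
  nlinarith [mul_lt_mul_of_pos_left hdist hv0, sq_nonneg ‖v‖]

theorem torsion_continuous_in_hausdorff_metric
    {n : ℕ} (hn : 2 ≤ n)
    (Ω : ℕ → Set (EuclideanSpace ℝ (Fin n))) (Ω₀ : Set (EuclideanSpace ℝ (Fin n)))
    (hcpt : ∀ i, IsCompact (Ω i)) (hconv : ∀ i, Convex ℝ (Ω i))
    (hint : ∀ i, (interior (Ω i)).Nonempty)
    (hcpt₀ : IsCompact Ω₀) (hconv₀ : Convex ℝ Ω₀) (hint₀ : (interior Ω₀).Nonempty)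
    (hconvg : Tendsto (fun i => Metric.hausdorffDist (Ω i) Ω₀) atTop (nhds 0)) :
    Tendsto (fun i => torsion (Ω i)) atTop (nhds (torsion Ω₀)) := by
  have hne : ∀ i, (Ω i).Nonempty := fun i => (hint i).mono interior_subset
  have hfin : ∀ i, Metric.hausdorffEDist (Ω i) Ω₀ ≠ ⊤ := fun i =>
    Metric.hausdorffEDist_ne_top_of_nonempty_of_bounded (hne i) (hint₀.mono interior_subset)
      (hcpt i).isBounded hcpt₀.isBounded
  obtain ⟨p, hp⟩ := hint₀
  obtain ⟨r, hr, hball⟩ :=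
    Metric.nhds_basis_closedBall.mem_iff.1 (mem_interior_iff_mem_nhds.1 hp)
  set ε : ℕ → ℝ := fun i => (Metric.hausdorffDist (Ω i) Ω₀ + 1 / ((i : ℝ) + 1)) / r with hεdef
  have hε_tendsto : Tendsto ε atTop (nhds 0) := by
    simpa [hεdef] using (hconvg.add tendsto_one_div_add_atTop_nhds_zero_nat).div_const r
  have hε_pos : ∀ i, 0 < ε i := fun i => by
    have := Metric.hausdorffDist_nonneg (s := Ω i) (t := Ω₀)
    positivity
  have hdist : ∀ i, Metric.hausdorffDist (Ω i) Ω₀ < ε i * r := fun i => by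
    rw [hεdef, div_mul_cancel₀ _ hr.ne']
    exact lt_add_of_pos_right _ (by positivity)
  have houter : ∀ i, ∀ x ∈ Ω i, p + (1 + ε i)⁻¹ • (x - p) ∈ Ω₀ := fun i x hx => by
    obtain ⟨y, hy, hxy⟩ := Metric.exists_dist_lt_of_hausdorffDist_lt hx (hdist i) (hfin i)
    exact hconv₀.homothety_mem_of_near (hε_pos i) hball hy hxy
  have hinner : ∀ i, ε i < 1 → ∀ x ∈ Ω₀, p + (1 - ε i) • (x - p) ∈ Ω i := fun i hi x hx =>
    hconv₀.homothety_mem_of_forall_near (hconv i) (hcpt i).isComplete (hne i) hr (hε_pos i) hi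
      hball (fun z hz => by
        obtain ⟨y, hy, hzy⟩ := Metric.exists_dist_lt_of_hausdorffDist_lt' hz (hdist i) (hfin i)
        exact ⟨y, hy, by rwa [dist_comm]⟩) hx
  have hε_lt : ∀ᶠ i in atTop, ε i < 1 := hε_tendsto.eventually_lt_const one_pos
  by_cases hbdd : BddAbove (torsionQuotients Ω₀)
  · have hbddi : ∀ i, BddAbove (torsionQuotients (Ω i)) := fun i =>
      hbdd.torsionQuotients_of_homothety (by have := hε_pos i; positivity) (houter i)
    have hlow : Tendsto (fun i => (1 - ε i) ^ (n + 2) * torsion Ω₀) atTop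
        (nhds (torsion Ω₀)) := by
      simpa using ((hε_tendsto.const_sub 1).pow (n + 2)).mul_const (torsion Ω₀)
    have hupp : Tendsto (fun i => (1 + ε i) ^ (n + 2) * torsion Ω₀) atTop
        (nhds (torsion Ω₀)) := by
      simpa using ((hε_tendsto.const_add 1).pow (n + 2)).mul_const (torsion Ω₀)
    refine tendsto_of_tendsto_of_tendsto_of_le_of_le' hlow hupp ?_ (Eventually.of_forall ?_)
    · filter_upwards [hε_lt] with i hi
      exact mul_torsion_le_of_homothety (sub_pos.2 hi) (hinner i hi) (hbddi i)
    · intro i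
      have hpos : 0 < 1 + ε i := add_pos one_pos (hε_pos i)
      have h := mul_torsion_le_of_homothety (inv_pos.2 hpos) (houter i) hbdd
      rwa [inv_pow, inv_mul_le_iff₀ (pow_pos hpos _)] at h
  · -- An unbounded supremum is `0` by convention, and unboundedness passes to nearby bodies.
    refine tendsto_const_nhds.congr' ?_
    filter_upwards [hε_lt] with i hi
    have hbddi : ¬ BddAbove (torsionQuotients (Ω i)) := fun h =>
      hbdd (h.torsionQuotients_of_homothety (sub_pos.2 hi) (hinner i hi))
    exact (Real.sSup_of_not_bddAbove hbdd).trans (Real.sSup_of_not_bddAbove hbddi).symm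
end
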